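/- Let d ≥ 4 be even, let k ≥ 4, let n = d/2, and let G be a nonempty connected simple graph. Let G' be the disjoint union of G and R_n together with an edge between the vertex c_0 of R_n and every vertex of G. Then G' has diameter exactly d, and G admits a proper vertex (k−1)-coloring if and only if G' admits a strong conflict-free vertex-connection k-coloring. -/

import Mathlib

open SimpleGraph

/-- `f` is a strong conflict-free vertex-connection coloring of `G`: any two distinct
vertices are joined by a shortest path on which some color occurs exactly once. -/
def IsSCFVC {V α : Type*} [DecidableEq α] (G : SimpleGraph V) (f : V → α) : Prop :=
  ∀ u v : V, u ≠ v → ∃ p : G.Walk u v, p.length = G.dist u v ∧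
    ∃ c : α, (p.support.map f).count c = 1

/-- Vertices of the graph `R (m+1)`: `A i`, `B i` are `a_{i+1}`, `b_{i+1}` for `i : Fin m`,
and `C j` is `c_j` for `j : Fin (m+2)`.  (`RV m` carries the vertices of `R_{m+1}`.) -/
inductive RV (m : ℕ) where
  | A : Fin m → RV m
  | B : Fin m → RV m
  | C : Fin (m + 2) → RV m
deriving DecidableEq

/-- The disjoint union of `G` and `R_{m+1}` together with an edge between the vertex `c_0`
of `R_{m+1}` and every vertex of `G`.  (`R_{m+1}` is `Q_m` plus a new vertex `c_{m+1}`
adjacent only to `c_m`.) -/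
def joinR {V : Type*} (G : SimpleGraph V) (m : ℕ) : SimpleGraph (V ⊕ RV m) :=
  SimpleGraph.fromRel (fun x y =>
    match x, y with
    | .inl u, .inl v => G.Adj u v
    | .inr (.A i), .inr (.B j) => i.val = j.val
    | .inr (.A i), .inr (.C j) => j.val = i.val ∨ j.val = i.val + 1
    | .inr (.B i), .inr (.C j) => j.val = i.val ∨ j.val = i.val + 1
    | .inr (.C i), .inr (.C j) => i.val = m ∧ j.val = m + 1
    | .inl _, .inr (.C j) => j.val = 0
    | _, _ => False)


def lev {V : Type*} {m : ℕ} : V ⊕ RV m → ℕ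
  | .inl _ => 0
  | .inr (.A i) => 2 * i.val + 2
  | .inr (.B i) => 2 * i.val + 2
  | .inr (.C j) => if j.val = m + 1 then 2 * m + 2 else 2 * j.val + 1

theorem lev_le {V : Type*} {m : ℕ} (x : V ⊕ RV m) : lev x ≤ 2 * m + 2 := by
  rcases x with v | i | i | i <;> simp only [lev] <;> (try split_ifs) <;> omega

theorem adj_of_lev {V : Type*} {G : SimpleGraph V} {m : ℕ} (x y : V ⊕ RV m)
    (h : lev x + 1 = lev y) : (joinR G m).Adj x y := by
  have hne : x ≠ y := by rintro rfl; omega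
  rw [joinR, SimpleGraph.fromRel_adj]
  refine ⟨hne, ?_⟩
  rcases x with v | i | i | i <;> rcases y with w | j | j | j <;> simp only [lev] at h <;>
    simp only [] <;> (try split_ifs at h) <;> omega

theorem lev_of_adj {V : Type*} {G : SimpleGraph V} {m : ℕ} (x y : V ⊕ RV m)
    (h : (joinR G m).Adj x y) : lev y ≤ lev x + 1 := by
  rw [joinR, SimpleGraph.fromRel_adj] at h
  obtain ⟨hne, h⟩ := h
  rcases x with v | i | i | i <;> rcases y with w | j | j | j <;> simp only [lev] <;>
    simp only [or_false, false_or, or_self] at h <;> (try split_ifs) <;> omega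

theorem adj_inl {V : Type*} {G : SimpleGraph V} {m : ℕ} (u v : V) :
    (joinR G m).Adj (.inl u) (.inl v) ↔ G.Adj u v := by
  rw [joinR, SimpleGraph.fromRel_adj]
  simp only [ne_eq, Sum.inl.injEq]
  exact ⟨fun h => h.2.elim id fun h => h.symm, fun h => ⟨h.ne, Or.inl h⟩⟩

/-- same level: both in `V`, or adjacent -/
theorem same_lev {V : Type*} {G : SimpleGraph V} {m : ℕ} (x y : V ⊕ RV m) (hne : x ≠ y)
    (h : lev x = lev y) : (∃ u v, x = .inl u ∧ y = .inl v) ∨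
      (joinR G m).Adj x y ∧ ((∃ i j, x = .inr (.A i) ∧ y = .inr (.B j)) ∨
        (∃ i j, x = .inr (.B i) ∧ y = .inr (.A j))) := by
  rw [joinR, SimpleGraph.fromRel_adj]
  rcases x with v | i | i | i <;> rcases y with w | j | j | j <;> simp only [lev] at h <;>
    (try split_ifs at h) <;>
    simp_all [Fin.ext_iff] <;> (try omega)

theorem lev_walk {V : Type*} {G : SimpleGraph V} {m : ℕ} {x y : V ⊕ RV m}
    (p : (joinR G m).Walk x y) : lev y ≤ lev x + p.length := by
  induction p with
  | nil => simp
  | cons h p ih =>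
    have := lev_of_adj _ _ h
    simp only [Walk.length_cons]; omega

theorem dist_of_walk {V : Type*} {G : SimpleGraph V} {m : ℕ} {x y : V ⊕ RV m}
    (p : (joinR G m).Walk x y) (h : lev x + p.length = lev y) :
    p.length = (joinR G m).dist x y := by
  obtain ⟨q, hq⟩ := p.reachable.exists_walk_length_eq_dist
  have := lev_walk q
  have := dist_le p
  omega

/-- monotone walk whose interior avoids the color `s` -/
theorem avoid {V α : Type*} {G : SimpleGraph V} {m : ℕ} (f : V ⊕ RV m → α) (s : α) (n : ℕ) :
    ∀ x y : V ⊕ RV m, lev x + (n + 1) = lev y →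
    (∀ l, lev x < l → l < lev y → ∃ z : V ⊕ RV m, lev z = l ∧ f z ≠ s) →
    ∃ p : (joinR G m).Walk x y, p.length = n + 1 ∧
      ∃ L : List α, p.support.map f = f x :: (L ++ [f y]) ∧ s ∉ L := by
  induction n with
  | zero =>
    intro x y h _
    exact ⟨Walk.cons (adj_of_lev x y (by omega)) Walk.nil, by simp, [], by simp, by simp⟩
  | succ n ih =>
    intro x y h H
    obtain ⟨z, hz, hzs⟩ := H (lev x + 1) (by omega) (by omega)
    obtain ⟨p, hp, L, hL, hs⟩ := ih z y (by omega) (fun l h1 h2 => H l (by omega) h2)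
    refine ⟨Walk.cons (adj_of_lev x z (by omega)) p, by simp [hp], f z :: L, ?_, ?_⟩
    · simp [hL]
    · simp only [List.mem_cons, not_or]; exact ⟨fun h => hzs h.symm, hs⟩

theorem exists_lev {V : Type*} [Nonempty V] {m : ℕ} (l : ℕ) (hl : l ≤ 2 * m + 2) :
    ∃ z : V ⊕ RV m, lev z = l := by
  rcases Nat.even_or_odd' l with ⟨j, rfl | rfl⟩
  · rcases j with _ | j
    · exact ⟨.inl (Classical.arbitrary V), rfl⟩
    · by_cases h : j < m
      · exact ⟨.inr (.A ⟨j, h⟩), by simp [lev]; omega⟩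
      · exact ⟨.inr (.C ⟨m + 1, by omega⟩), by simp [lev]; omega⟩
  · exact ⟨.inr (.C ⟨j, by omega⟩), by simp [lev]; omega⟩

theorem up_walk {V : Type*} [Nonempty V] {G : SimpleGraph V} {m : ℕ} (x y : V ⊕ RV m)
    (h : lev x < lev y) :
    ∃ p : (joinR G m).Walk x y, p.length = lev y - lev x := by
  obtain ⟨n, hn⟩ := Nat.exists_eq_add_of_lt h
  obtain ⟨p, hp, -⟩ := avoid (G := G) (fun _ => false) true n x y (by omega)
    (fun l _ h2 => by
      obtain ⟨z, hz⟩ := exists_lev (V := V) (m := m) l (by have := lev_le y; omega)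
      exact ⟨z, hz, by simp⟩)
  exact ⟨p, by omega⟩

theorem diam_eq {V : Type*} [Nonempty V] (G : SimpleGraph V) (m : ℕ) :
    (joinR G m).diam = 2 * m + 2 := by
  have key : (joinR G m).ediam = ((2 * m + 2 : ℕ) : ℕ∞) := by
    apply le_antisymm
    · apply ediam_le_of_edist_le
      intro x y
      have : ∃ p : (joinR G m).Walk x y, p.length ≤ 2 * m + 2 := by
        rcases lt_trichotomy (lev x) (lev y) with h | h | h
        · obtain ⟨p, hp⟩ := up_walk (G := G) x y h
          exact ⟨p, by have := lev_le y; omega⟩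
        · by_cases hxy : x = y
          · subst hxy; exact ⟨Walk.nil, by simp⟩
          rcases same_lev (G := G) x y hxy h with ⟨u, v, rfl, rfl⟩ | ⟨h, -⟩
          · obtain ⟨z, hz⟩ := exists_lev (V := V) (m := m) 1 (by omega)
            exact ⟨Walk.cons (adj_of_lev _ z (by rw [hz]; rfl))
              (Walk.cons (adj_of_lev _ z (by rw [hz]; rfl)).symm Walk.nil), by simp⟩
          · exact ⟨Walk.cons h Walk.nil, by simp⟩
        · obtain ⟨p, hp⟩ := up_walk (G := G) y x h
          exact ⟨p.reverse, by have := lev_le x; simp; omega⟩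
      obtain ⟨p, hp⟩ := this
      exact (edist_le p).trans (by exact_mod_cast hp)
    · obtain ⟨x, hx⟩ := exists_lev (V := V) (m := m) 0 (by omega)
      obtain ⟨y, hy⟩ := exists_lev (V := V) (m := m) (2 * m + 2) (by omega)
      refine le_trans ?_ (edist_le_ediam (u := x) (v := y))
      obtain ⟨p, hp⟩ := up_walk (G := G) x y (by omega)
      have h := dist_of_walk p (by omega)
      rw [← p.reachable.coe_dist_eq_edist, ← h]
      exact_mod_cast (by omega : 2 * m + 2 ≤ p.length)
  rw [diam, key]; rfl

def Good {W α : Type*} [DecidableEq α] (H : SimpleGraph W) (f : W → α) (u v : W) : Prop :=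
  ∃ p : H.Walk u v, p.length = H.dist u v ∧ ∃ c : α, (p.support.map f).count c = 1

theorem Good.symm {W α : Type*} [DecidableEq α] {H : SimpleGraph W} {f : W → α} {u v : W}
    (h : Good H f u v) : Good H f v u := by
  obtain ⟨p, hp, c, hc⟩ := h
  refine ⟨p.reverse, by rw [Walk.length_reverse, hp, dist_comm], c, ?_⟩
  rw [Walk.support_reverse, List.map_reverse, List.count_reverse, hc]

theorem good_adj {W α : Type*} [DecidableEq α] {H : SimpleGraph W} {f : W → α} {u v : W}
    (h : H.Adj u v) (hf : f u ≠ f v) : Good H f u v :=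
  ⟨Walk.cons h Walk.nil, by simp [dist_eq_one_iff_adj.2 h], f u, by simp [hf.symm]⟩

/-- the coloring of `G'` -/
def bigCol {V : Type*} {m k : ℕ} (hk : 4 ≤ k) (col : V → Fin (k - 1)) : V ⊕ RV m → Fin k
  | .inl v => ⟨(col v).val + 1, by omega⟩
  | .inr (.A _) => ⟨2, by omega⟩
  | .inr (.B _) => ⟨3, by omega⟩
  | .inr (.C j) => if j.val = 0 then ⟨0, by omega⟩ else if j.val = m + 1 then ⟨2, by omega⟩
      else ⟨1, by omega⟩

section
variable {V : Type*} {m k : ℕ} (hk : 4 ≤ k) (col : V → Fin (k - 1))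

theorem col_facts (x : V ⊕ RV m) :
    (lev x = 0 ∧ (bigCol hk col x).val ≠ 0) ∨ (lev x = 1 ∧ (bigCol hk col x).val = 0) ∨
    (3 ≤ lev x ∧ lev x % 2 = 1 ∧ (bigCol hk col x).val = 1) ∨
    (2 ≤ lev x ∧ lev x % 2 = 0 ∧ ((bigCol hk col x).val = 2 ∨ (bigCol hk col x).val = 3)) := by
  rcases x with v | i | i | i <;> simp only [lev, bigCol] <;> (try split_ifs) <;>
    (try dsimp only) <;> first | omega | simp

theorem pick_even (l s : ℕ) (h1 : 2 ≤ l) (h2 : l < 2 * m + 2) (h3 : l % 2 = 0)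
    (hs : s = 2 ∨ s = 3) : ∃ z : V ⊕ RV m, lev z = l ∧ (bigCol hk col z).val = s := by
  rcases hs with rfl | rfl
  · exact ⟨.inr (.A ⟨l / 2 - 1, by omega⟩), by simp [lev]; omega, rfl⟩
  · exact ⟨.inr (.B ⟨l / 2 - 1, by omega⟩), by simp [lev]; omega, rfl⟩

theorem pick_avoid (l : ℕ) (s : Fin k) (h1 : 1 ≤ l) (h2 : l < 2 * m + 2)
    (hs : s.val = 2 ∨ s.val = 3 ∨ (s.val = 0 ∧ 2 ≤ l)) :
    ∃ z : V ⊕ RV m, lev z = l ∧ bigCol hk col z ≠ s := by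
  rcases Nat.mod_two_eq_zero_or_one l with h | h
  · obtain ⟨z, hz, hc⟩ := pick_even (V := V) (m := m) hk col l (if s.val = 2 then 3 else 2)
      (by omega) h2 h (by split_ifs <;> simp)
    refine ⟨z, hz, fun h => ?_⟩
    rw [h] at hc
    split_ifs at hc <;> omega
  · have : ∃ z : V ⊕ RV m, lev z = l := ⟨.inr (.C ⟨l / 2, by omega⟩), by simp only [lev]; split_ifs <;> omega⟩
    obtain ⟨z, hz⟩ := this
    refine ⟨z, hz, fun h => ?_⟩
    have := col_facts hk col z
    rw [h] at this
    omega

theorem pick_odd (l : ℕ) (h1 : l % 2 = 1) (h2 : l < 2 * m + 2) :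
    ∃ z : V ⊕ RV m, lev z = l :=
  ⟨.inr (.C ⟨l / 2, by omega⟩), by simp only [lev]; split_ifs <;> omega⟩

theorem good_diff {G : SimpleGraph V} (x y : V ⊕ RV m) (h : lev x < lev y) (s : Fin k)
    (hs : s.val = 2 ∨ s.val = 3 ∨ (s.val = 0 ∧ 1 ≤ lev x))
    (hxy : bigCol hk col x ≠ bigCol hk col y)
    (hs' : s = bigCol hk col x ∨ s = bigCol hk col y) :
    Good (joinR G m) (bigCol hk col) x y := by
  obtain ⟨n, hn⟩ := Nat.exists_eq_add_of_lt h
  have := lev_le y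
  obtain ⟨p, hp, L, hL, hsL⟩ := avoid (G := G) (bigCol hk col) s n x y (by omega)
    (fun l h1 h2 => pick_avoid hk col l s (by omega) (by omega) (by omega))
  refine ⟨p, dist_of_walk p (by omega), s, ?_⟩
  rw [hL]
  have h0 := List.count_eq_zero_of_not_mem hsL
  rcases hs' with rfl | rfl
  · simp [List.count_append, h0, hxy.symm]
  · simp [List.count_append, h0, hxy]

theorem good_up {G : SimpleGraph V} (x y : V ⊕ RV m) (h : lev x < lev y) :
    Good (joinR G m) (bigCol hk col) x y := by
  have hx := col_facts hk col x
  have hy := col_facts hk col y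
  have hly := lev_le y
  by_cases hxy : bigCol hk col x = bigCol hk col y
  · rw [hxy] at hx
    by_cases h0 : lev x = 0
    · obtain ⟨z, hz⟩ := pick_odd (V := V) (m := m) 1 rfl (by omega)
      have hcz := col_facts hk col z
      obtain ⟨n, hn⟩ := Nat.exists_eq_add_of_lt (show lev z < lev y by omega)
      obtain ⟨p, hp, L, hL, hsL⟩ := avoid (G := G) (bigCol hk col) (bigCol hk col z) n z y
        (by omega) (fun l h1 h2 => pick_avoid hk col l _ (by omega) (by omega) (by omega))
      refine ⟨Walk.cons (adj_of_lev x z (by omega)) p,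
        dist_of_walk _ (by simp only [Walk.length_cons]; omega), bigCol hk col z, ?_⟩
      have e : bigCol hk col y ≠ bigCol hk col z := by
        intro h; rw [h] at hx hy; omega
      rw [Walk.support_cons, List.map_cons, hL, hxy]
      simp [List.count_append, List.count_eq_zero_of_not_mem hsL, e]
    · rcases Nat.mod_two_eq_zero_or_one (lev x) with he | ho
      · obtain ⟨z, hz⟩ := pick_odd (V := V) (m := m) (lev x + 1) (by omega) (by omega)
        have hcz := col_facts hk col z
        by_cases h2 : lev y = lev x + 2
        · refine ⟨Walk.cons (adj_of_lev x z (by omega))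
            (Walk.cons (adj_of_lev z y (by omega)) Walk.nil),
            dist_of_walk _ (by simp; omega), bigCol hk col z, ?_⟩
          have e : bigCol hk col y ≠ bigCol hk col z := by
            intro h; rw [h] at hx hy; omega
          simp [hxy, e]
        · obtain ⟨w, hw, hcw⟩ := pick_even (V := V) (m := m) hk col (lev x + 2)
            (if (bigCol hk col y).val = 2 then 3 else 2)
            (by omega) (by omega) (by omega) (by split_ifs <;> simp)
          have hcw' : (bigCol hk col w).val = 2 ∨ (bigCol hk col w).val = 3 := by
            split_ifs at hcw <;> omega
          have e : bigCol hk col y ≠ bigCol hk col w := by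
            intro h; rw [h] at hcw; split_ifs at hcw <;> omega
          have e' : bigCol hk col z ≠ bigCol hk col w := by
            intro h; rw [h] at hcz; omega
          obtain ⟨n, hn⟩ := Nat.exists_eq_add_of_lt (show lev w < lev y by omega)
          obtain ⟨p, hp, L, hL, hsL⟩ := avoid (G := G) (bigCol hk col) (bigCol hk col w) n w y
            (by omega) (fun l h1 h2 => pick_avoid hk col l _ (by omega) (by omega) (by omega))
          refine ⟨Walk.cons (adj_of_lev x z (by omega)) (Walk.cons (adj_of_lev z w (by omega)) p),
            dist_of_walk _ (by simp only [Walk.length_cons]; omega), bigCol hk col w, ?_⟩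
          rw [Walk.support_cons, Walk.support_cons, List.map_cons, List.map_cons, hL, hxy]
          simp [List.count_append, List.count_eq_zero_of_not_mem hsL, e, e']
      · obtain ⟨w, hw, hcw⟩ := pick_even (V := V) (m := m) hk col (lev x + 1) 2
          (by omega) (by omega) (by omega) (by simp)
        have e : bigCol hk col y ≠ bigCol hk col w := by
          intro h; rw [h] at hx hy; omega
        obtain ⟨n, hn⟩ := Nat.exists_eq_add_of_lt (show lev w < lev y by omega)
        obtain ⟨p, hp, L, hL, hsL⟩ := avoid (G := G) (bigCol hk col) (bigCol hk col w) n w y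
          (by omega) (fun l h1 h2 => pick_avoid hk col l _ (by omega) (by omega) (by omega))
        refine ⟨Walk.cons (adj_of_lev x w (by omega)) p,
          dist_of_walk _ (by simp only [Walk.length_cons]; omega), bigCol hk col w, ?_⟩
        rw [Walk.support_cons, List.map_cons, hL, hxy]
        simp [List.count_append, List.count_eq_zero_of_not_mem hsL, e]
  · by_cases h1 : lev x + 1 = lev y
    · exact good_adj (adj_of_lev x y h1) hxy
    by_cases h0 : lev x = 0
    · obtain ⟨z, hz⟩ := pick_odd (V := V) (m := m) 1 rfl (by omega)
      have hcz := col_facts hk col z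
      obtain ⟨n, hn⟩ := Nat.exists_eq_add_of_lt (show lev z < lev y by omega)
      obtain ⟨p, hp, L, hL, hsL⟩ := avoid (G := G) (bigCol hk col) (bigCol hk col z) n z y
        (by omega) (fun l h1 h2 => pick_avoid hk col l _ (by omega) (by omega) (by omega))
      refine ⟨Walk.cons (adj_of_lev x z (by omega)) p,
        dist_of_walk _ (by simp only [Walk.length_cons]; omega), bigCol hk col z, ?_⟩
      have e : bigCol hk col y ≠ bigCol hk col z := by
        intro h; rw [h] at hy; omega
      have e' : bigCol hk col x ≠ bigCol hk col z := by
        intro h; rw [h] at hx; omega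
      rw [Walk.support_cons, List.map_cons, hL]
      simp [List.count_append, List.count_eq_zero_of_not_mem hsL, e, e']
    · have hv : (bigCol hk col x).val ≠ (bigCol hk col y).val := fun h => hxy (Fin.ext h)
      by_cases hc : (bigCol hk col x).val = 1
      · exact good_diff hk col x y h _ (by omega) hxy (Or.inr rfl)
      · exact good_diff hk col x y h _ (by omega) hxy (Or.inl rfl)

theorem good_all {G : SimpleGraph V} (hcol : ∀ u v, G.Adj u v → col u ≠ col v) :
    IsSCFVC (joinR G m) (bigCol hk col) := by
  intro x y hne
  change Good _ _ x y
  rcases lt_trichotomy (lev x) (lev y) with h | h | h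
  · exact good_up hk col x y h
  · rcases same_lev (G := G) x y hne h with ⟨u, v, rfl, rfl⟩ | ⟨ha, ⟨i, j, rfl, rfl⟩ | ⟨i, j, rfl, rfl⟩⟩
    · by_cases ha : G.Adj u v
      · refine good_adj ((adj_inl u v).2 ha) ?_
        have := hcol u v ha
        simp only [bigCol, ne_eq, Fin.mk.injEq]
        intro h; exact this (Fin.ext (by omega))
      · obtain ⟨z, hz⟩ := pick_odd (V := V) (m := m) 1 rfl (by omega)
        have hcz := col_facts hk col z
        have hcu := col_facts (m := m) hk col (.inl u)
        have hcv := col_facts (m := m) hk col (.inl v)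
        have e1 : bigCol (m := m) hk col (.inl u) ≠ bigCol hk col z := by
          intro h; rw [h] at hcu; simp only [lev] at hcu; omega
        have e2 : bigCol (m := m) hk col (.inl v) ≠ bigCol hk col z := by
          intro h; rw [h] at hcv; simp only [lev] at hcv; omega
        let p : (joinR G m).Walk (.inl u) (.inl v) :=
          Walk.cons (adj_of_lev _ z (by rw [hz]; rfl))
              (Walk.cons (adj_of_lev _ z (by rw [hz]; rfl)).symm Walk.nil)
        have hp : p.length = 2 := rfl
        refine ⟨p, ?_, bigCol hk col z, ?_⟩
        · have h1 := dist_le p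
          have h2 : (joinR G m).dist (.inl u) (.inl v) ≠ 0 := by
            rw [Ne, p.reachable.dist_eq_zero_iff]; exact hne
          have h3 : (joinR G m).dist (.inl u) (.inl v) ≠ 1 := by
            rw [Ne, dist_eq_one_iff_adj, adj_inl]; exact ha
          omega
        · simp [p, e1, e2]
    · exact good_adj ha (by simp [bigCol])
    · exact good_adj ha (by simp [bigCol])
  · exact (good_up hk col y x h).symm

end

theorem scfvc_proper {W α : Type*} [DecidableEq α] {H : SimpleGraph W} {f : W → α}
    (h : IsSCFVC H f) {u v : W} (ha : H.Adj u v) : f u ≠ f v := by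
  obtain ⟨p, hp, c, hc⟩ := h u v ha.ne
  rw [dist_eq_one_iff_adj.2 ha] at hp
  intro hf
  cases p with
  | nil => simp at hp
  | cons h' q =>
    cases q with
    | nil =>
      simp only [Walk.support_cons, Walk.support_nil, List.map_cons, List.map_nil, hf,
        List.count_cons, List.count_nil] at hc
      split_ifs at hc <;> omega
    | cons _ _ => simp at hp

theorem colorable_of {V : Type*} {G : SimpleGraph V} {m k : ℕ} (f : V ⊕ RV m → Fin k)
    (h : IsSCFVC (joinR G m) f) : G.Colorable (k - 1) := by
  let c : V ⊕ RV m := .inr (.C 0)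
  have hc : ∀ v : V, f (.inl v) ≠ f c := fun v =>
    scfvc_proper h (adj_of_lev _ _ (by simp [lev, c]))
  let g : G.Coloring {t : Fin k // t ≠ f c} :=
    Coloring.mk (fun v => ⟨f (.inl v), hc v⟩) (by
      intro u v ha hf
      exact scfvc_proper h ((adj_inl u v).2 ha) (by simpa using hf))
  have := g.colorable
  simpa [Fintype.card_subtype_compl] using this

/-- For even `d ≥ 4` and `k ≥ 4`, with `n = d/2`: the graph `G'` obtained from a
nonempty connected graph `G` and `R n` (realized as `joinR G (n-1)`, since `RV (n-1)`
carries `R n`) by joining `c_0` to all of `G` has diameter exactly `d`, and `G` is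
`(k-1)`-colorable iff `G'` is strongly conflict-free vertex-connection `k`-colorable. -/
theorem stmt9 {V : Type*} [Fintype V] [Nonempty V] (G : SimpleGraph V) (hG : G.Connected)
    (d k : ℕ) (hd : 4 ≤ d) (heven : Even d) (hk : 4 ≤ k) :
    (joinR G (d / 2 - 1)).diam = d ∧
    (G.Colorable (k - 1) ↔
      ∃ f : V ⊕ RV (d / 2 - 1) → Fin k, IsSCFVC (joinR G (d / 2 - 1)) f) := by
  have hm : 2 * (d / 2 - 1) + 2 = d := by
    obtain ⟨r, rfl⟩ := heven
    omega
  refine ⟨by rw [diam_eq, hm], ?_, ?_⟩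
  · rintro ⟨c⟩
    exact ⟨bigCol hk c, good_all hk c fun u v h => c.valid h⟩
  · rintro ⟨f, hf⟩
    exact colorable_of f hf
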